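/- Let Φ(r) = ∫_0^r φ(t) dt be an increasing unbounded convex function on (0,1), where φ is continuous, increasing and unbounded, and assume that either φ(r)(1−r) ≍ 1 as r → 1⁻ or lim_{r→1⁻} φ(r)(1−r) = 0. Then there exists an analytic function g on 𝔻 such that log M_∞(r,g) ≍ m(r,g) ≍ Φ(r) as r → 1⁻, where M_∞(r,g) = max_{0≤θ≤2π} |g(re^{iθ})| and m(r,g) = (1/2π) ∫_0^{2π} log⁺ |g(re^{iθ})| dθ is the Nevanlinna proximity function. -/

import Mathlib

open MeasureTheory Set Filter

noncomputable section

/-- The open unit disc in `ℂ`. -/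
def unitDisc : Set ℂ := {z : ℂ | ‖z‖ < 1}

/-- The maximum modulus `M_∞(r,g) = max_{0 ≤ θ ≤ 2π} |g(re^{iθ})|`. -/
def Minf (g : ℂ → ℂ) (r : ℝ) : ℝ :=
  sSup ((fun θ : ℝ => ‖g ((r : ℂ) * Complex.exp (θ * Complex.I))‖) ''
    Set.Icc 0 (2 * Real.pi))

/-- The Nevanlinna proximity function
`m(r,g) = (1/2π) ∫_0^{2π} log⁺ |g(re^{iθ})| dθ`. -/
def proxFn (g : ℂ → ℂ) (r : ℝ) : ℝ :=
  (1 / (2 * Real.pi)) *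
    ∫ θ in (0:ℝ)..(2 * Real.pi),
      max (Real.log ‖g ((r : ℂ) * Complex.exp (θ * Complex.I))‖) 0

/-- The lacunary series `∑ exp (L 2^j) z^{n_j}`. -/
def lacunarySeries (L : ℝ) (n : ℕ → ℕ) (z : ℂ) : ℂ :=
  ∑' j, (Real.exp (L * 2 ^ j) : ℂ) * z ^ n j

theorem sum_exp_mul_two_pow_le {L : ℝ} (hL : 10 ≤ L) (k : ℕ) :
    ∑ j ∈ Finset.range k, Real.exp (L * 2 ^ j) ≤ Real.exp (L * 2 ^ k - 4) := by
  induction k with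
  | zero => simpa using (Real.exp_pos _).le
  | succ k ih =>
    have h1 : (1 : ℝ) ≤ 2 ^ k := one_le_pow₀ (by norm_num)
    have h10 : 10 ≤ L * 2 ^ k := by nlinarith
    rw [Finset.sum_range_succ]
    calc _ ≤ Real.exp (L * 2 ^ k) + Real.exp (L * 2 ^ k) := by
          gcongr
          exact ih.trans (Real.exp_le_exp.2 (by linarith))
      _ = 2 * Real.exp (L * 2 ^ k) := by ring
      _ ≤ Real.exp 1 * Real.exp (L * 2 ^ k) := by
          gcongr
          linarith [Real.exp_one_gt_d9]
      _ ≤ _ := by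
          rw [← Real.exp_add]
          apply Real.exp_le_exp.2
          rw [pow_succ]
          linarith

theorem exp_neg_mul_two_pow_le {L : ℝ} (hL : 10 ≤ L) (j k : ℕ) :
    Real.exp (-(L * 2 ^ (j + k))) ≤ 1 / 2 / 2 ^ j := by
  have h1 : ((j : ℝ) + 1) ≤ 2 ^ j := by
    exact_mod_cast Nat.lt_two_pow_self
  have h2 : (2 : ℝ) ^ j ≤ 2 ^ (j + k) := pow_le_pow_right₀ (by norm_num) (by omega)
  have h3 : ((j : ℝ) + 1) ≤ L * 2 ^ (j + k) := by nlinarith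
  calc Real.exp (-(L * 2 ^ (j + k))) ≤ Real.exp (-((j : ℝ) + 1)) :=
        Real.exp_le_exp.2 (by linarith)
    _ = (Real.exp 1 ^ (j + 1))⁻¹ := by
        rw [Real.exp_neg, ← Real.exp_nat_mul]
        push_cast
        simp
    _ ≤ (2 ^ (j + 1))⁻¹ := by
        gcongr
        linarith [Real.exp_one_gt_d9]
    _ = _ := by
        rw [pow_succ]
        field_simp

section Series

variable {L : ℝ} {n : ℕ → ℕ} {ρ : ℕ → ℝ}

theorem norm_lacunaryTerm_le (hL : 10 ≤ L)
    (htail : ∀ i j, i < j → Real.exp (L * 2 ^ j) * ρ i ^ n j ≤ Real.exp (-(L * 2 ^ j)))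
    {k : ℕ} {z : ℂ} (hz : ‖z‖ ≤ ρ k) (j : ℕ) :
    ‖(Real.exp (L * 2 ^ (j + (k + 1))) : ℂ) * z ^ n (j + (k + 1))‖ ≤ 1 / 2 / 2 ^ j := by
  refine le_trans ?_ (exp_neg_mul_two_pow_le hL j (k + 1))
  refine le_trans ?_ (htail k (j + (k + 1)) (by omega))
  rw [norm_mul, norm_pow, Complex.norm_real, Real.norm_of_nonneg (Real.exp_pos _).le]
  gcongr

theorem summable_lacunaryTerm (hL : 10 ≤ L)
    (htail : ∀ i j, i < j → Real.exp (L * 2 ^ j) * ρ i ^ n j ≤ Real.exp (-(L * 2 ^ j)))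
    {k : ℕ} {z : ℂ} (hz : ‖z‖ ≤ ρ k) :
    Summable fun j => (Real.exp (L * 2 ^ j) : ℂ) * z ^ n j := by
  rw [← summable_nat_add_iff (k + 1)]
  exact Summable.of_norm_bounded (hasSum_geometric_two' 1).summable
    (norm_lacunaryTerm_le hL htail hz)

theorem norm_lacunarySeries_sub_sum_le (hL : 10 ≤ L)
    (htail : ∀ i j, i < j → Real.exp (L * 2 ^ j) * ρ i ^ n j ≤ Real.exp (-(L * 2 ^ j)))
    {k : ℕ} {z : ℂ} (hz : ‖z‖ ≤ ρ k) :
    ‖lacunarySeries L n z -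
      ∑ j ∈ Finset.range (k + 1), (Real.exp (L * 2 ^ j) : ℂ) * z ^ n j‖ ≤ 1 := by
  rw [lacunarySeries, ← (summable_lacunaryTerm hL htail hz).sum_add_tsum_nat_add (k + 1),
    add_sub_cancel_left]
  exact tsum_of_norm_bounded (hasSum_geometric_two' 1) (norm_lacunaryTerm_le hL htail hz)

theorem differentiableOn_lacunarySeries (hL : 10 ≤ L)
    (htail : ∀ i j, i < j → Real.exp (L * 2 ^ j) * ρ i ^ n j ≤ Real.exp (-(L * 2 ^ j)))
    (hρ : ∀ s < 1, ∃ k, s < ρ k) :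
    DifferentiableOn ℂ (lacunarySeries L n) {z | ‖z‖ < 1} := by
  intro z hz
  obtain ⟨k, hk⟩ := hρ _ hz
  have hρk : 0 ≤ ρ k := (norm_nonneg z).trans hk.le
  refine DifferentiableAt.differentiableWithinAt ?_
  have hball : Metric.ball (0 : ℂ) (ρ k) ∈ nhds z :=
    Metric.isOpen_ball.mem_nhds (by simpa using hk)
  refine DifferentiableOn.differentiableAt ?_ hball
  have hsum : Summable fun j => ‖(Real.exp (L * 2 ^ j) : ℂ) * (ρ k : ℂ) ^ n j‖ :=
    (summable_lacunaryTerm hL htail (k := k) (z := (ρ k : ℂ))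
      (by rw [Complex.norm_real, Real.norm_of_nonneg hρk])).norm
  refine Complex.differentiableOn_tsum_of_summable_norm hsum (fun j => ?_)
    Metric.isOpen_ball fun j w hw => ?_
  · fun_prop
  · rw [norm_mul, norm_mul, norm_pow, norm_pow, Complex.norm_real (ρ k),
      Real.norm_of_nonneg hρk]
    have : ‖w‖ ≤ ρ k := (by simpa using hw : ‖w‖ < ρ k).le
    gcongr

theorem norm_sum_lacunaryTerm_le (hL : 10 ≤ L) {z : ℂ} (hz : ‖z‖ ≤ 1) (k : ℕ) :
    ‖∑ j ∈ Finset.range k, (Real.exp (L * 2 ^ j) : ℂ) * z ^ n j‖ ≤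
      Real.exp (L * 2 ^ k - 4) := by
  refine (norm_sum_le _ _).trans (le_trans ?_ (sum_exp_mul_two_pow_le hL k))
  refine Finset.sum_le_sum fun j _ => ?_
  rw [norm_mul, norm_pow, Complex.norm_real, Real.norm_of_nonneg (Real.exp_pos _).le]
  exact mul_le_of_le_one_right (Real.exp_pos _).le (pow_le_one₀ (norm_nonneg _) hz)

theorem norm_lacunarySeries_le (hL : 10 ≤ L)
    (htail : ∀ i j, i < j → Real.exp (L * 2 ^ j) * ρ i ^ n j ≤ Real.exp (-(L * 2 ^ j)))
    {k : ℕ} {z : ℂ} (hz1 : ‖z‖ ≤ 1) (hz : ‖z‖ ≤ ρ (k + 1)) :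
    ‖lacunarySeries L n z‖ ≤ Real.exp (4 * (L * 2 ^ k)) := by
  have h1 := norm_lacunarySeries_sub_sum_le hL htail hz
  have h2 := norm_sum_lacunaryTerm_le (n := n) hL hz1 (k + 1 + 1)
  have h3 := norm_le_norm_add_norm_sub'
    (lacunarySeries L n z)
    (∑ j ∈ Finset.range (k + 1 + 1), (Real.exp (L * 2 ^ j) : ℂ) * z ^ n j)
  have hpow : (1 : ℝ) ≤ 2 ^ k := one_le_pow₀ (by norm_num)
  have h4 : L * 2 ^ (k + 1 + 1) - 4 = 4 * (L * 2 ^ k) - 4 := by ring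
  rw [h4] at h2
  have h5 : Real.exp (4 * (L * 2 ^ k)) =
      Real.exp 4 * Real.exp (4 * (L * 2 ^ k) - 4) := by
    rw [← Real.exp_add]
    ring_nf
  have h6 : (1 : ℝ) ≤ Real.exp (4 * (L * 2 ^ k) - 4) := Real.one_le_exp (by nlinarith)
  have h7 := Real.add_one_le_exp (4 : ℝ)
  nlinarith

theorem exp_le_norm_lacunarySeries (hL : 10 ≤ L)
    (htail : ∀ i j, i < j → Real.exp (L * 2 ^ j) * ρ i ^ n j ≤ Real.exp (-(L * 2 ^ j)))
    (hmain : ∀ j, Real.exp (-3) ≤ ρ j ^ n j) (hρ0 : ∀ j, 0 ≤ ρ j)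
    {k N : ℕ} (hN : n (k + 1) = n k + N) {r θ : ℝ} (hr1 : r ≤ 1) (hrk : ρ k ≤ r)
    (hrk' : r ≤ ρ (k + 1)) (hcos : 0 ≤ Real.cos (N * θ)) :
    Real.exp (L * 2 ^ k / 2) ≤ ‖lacunarySeries L n (r * Complex.exp (θ * Complex.I))‖ := by
  have hr0 : 0 ≤ r := (hρ0 k).trans hrk
  set z : ℂ := r * Complex.exp (θ * Complex.I) with hzdef
  have hz : ‖z‖ = r := by
    rw [hzdef, norm_mul, Complex.norm_exp_ofReal_mul_I, Complex.norm_real,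
      Real.norm_of_nonneg hr0, mul_one]
  have h1 := norm_lacunarySeries_sub_sum_le hL htail (hz.le.trans hrk')
  have h2 := norm_sum_lacunaryTerm_le (n := n) hL (hz.le.trans hr1) k
  rw [Finset.sum_range_succ, Finset.sum_range_succ] at h1
  set S := ∑ j ∈ Finset.range k, (Real.exp (L * 2 ^ j) : ℂ) * z ^ n j
  set A := Real.exp (L * 2 ^ k)
  set B := Real.exp (L * 2 ^ (k + 1))
  have hA : 0 < A := Real.exp_pos _
  have hB : 0 < B := Real.exp_pos _
  have hzN : z ^ N = ((r ^ N : ℝ) : ℂ) * Complex.exp ((N * θ : ℝ) * Complex.I) := by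
    rw [hzdef, mul_pow, ← Complex.exp_nat_mul]
    push_cast
    ring_nf
  have hre : A ≤ ‖(A : ℂ) + B * z ^ N‖ := by
    refine le_trans ?_ (Complex.re_le_norm _)
    have : ((A : ℂ) + B * z ^ N).re = A + B * (r ^ N * Real.cos (N * θ)) := by
      rw [hzN, Complex.add_re, Complex.re_ofReal_mul, Complex.re_ofReal_mul,
        Complex.exp_ofReal_mul_I_re, Complex.ofReal_re]
    rw [this]
    have : 0 ≤ B * (r ^ N * Real.cos (N * θ)) := by positivity
    linarith
  have hpair : A * Real.exp (-3) ≤ ‖(A : ℂ) * z ^ n k + B * z ^ n (k + 1)‖ := by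
    have : (A : ℂ) * z ^ n k + B * z ^ n (k + 1) = (A + B * z ^ N) * z ^ n k := by
      rw [hN, pow_add]
      ring
    rw [this, norm_mul, norm_pow, hz]
    have : Real.exp (-3) ≤ r ^ n k := (hmain k).trans (by
      have := hρ0 k
      gcongr)
    gcongr
  have htri : ‖(A : ℂ) * z ^ n k + B * z ^ n (k + 1)‖ ≤
      ‖lacunarySeries L n z‖ + ‖lacunarySeries L n z -
        (S + (A : ℂ) * z ^ n k + B * z ^ n (k + 1))‖ + ‖S‖ := by
    have : (A : ℂ) * z ^ n k + B * z ^ n (k + 1) = lacunarySeries L n z - (lacunarySeries L n z -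
        (S + (A : ℂ) * z ^ n k + B * z ^ n (k + 1))) - S := by ring
    conv_lhs => rw [this]
    exact (norm_sub_le _ _).trans (add_le_add (norm_sub_le _ _) le_rfl)
  have hpow : (1 : ℝ) ≤ 2 ^ k := one_le_pow₀ (by norm_num)
  have hu : 10 ≤ L * 2 ^ k := by nlinarith
  set X := Real.exp (L * 2 ^ k - 5)
  have hX1 : 1 ≤ X := Real.one_le_exp (by linarith)
  have e1 : A * Real.exp (-3) = Real.exp 1 * (Real.exp 1 * X) := by
    rw [← Real.exp_add, ← Real.exp_add, ← Real.exp_add]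
    ring_nf
  have e2 : Real.exp (L * 2 ^ k - 4) = Real.exp 1 * X := by
    rw [← Real.exp_add]
    ring_nf
  have e3 : Real.exp (L * 2 ^ k / 2) ≤ X := Real.exp_le_exp.2 (by linarith)
  have he := Real.exp_one_gt_d9
  have h8 : 2.7 * X ≤ Real.exp 1 * X := by nlinarith
  have h9 : 2.7 * (Real.exp 1 * X) ≤ Real.exp 1 * (Real.exp 1 * X) := by nlinarith
  linarith

theorem exists_pos_add_exponent (hL : 10 ≤ L)
    (htail : ∀ i j, i < j → Real.exp (L * 2 ^ j) * ρ i ^ n j ≤ Real.exp (-(L * 2 ^ j)))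
    (hmain : ∀ j, Real.exp (-3) ≤ ρ j ^ n j) (hρ0 : ∀ j, 0 ≤ ρ j) (hρ1 : ∀ j, ρ j ≤ 1)
    (k : ℕ) : ∃ N : ℕ, 0 < N ∧ n (k + 1) = n k + N := by
  suffices n k < n (k + 1) from ⟨n (k + 1) - n k, by omega, by omega⟩
  by_contra! hle
  have h1 : Real.exp (-3) ≤ ρ k ^ n (k + 1) :=
    (hmain k).trans (pow_le_pow_of_le_one (hρ0 k) (hρ1 k) hle)
  have hpow : (1 : ℝ) ≤ 2 ^ (k + 1) := one_le_pow₀ (by norm_num)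
  have hu : 10 ≤ L * 2 ^ (k + 1) := by nlinarith
  have h2 : Real.exp (L * 2 ^ (k + 1)) * Real.exp (-3) ≤ Real.exp (-(L * 2 ^ (k + 1))) :=
    le_trans (by gcongr) (htail k (k + 1) (by omega))
  rw [← Real.exp_add, Real.exp_le_exp] at h2
  linarith

end Series

theorem integral_cos_add_cos_sq {N : ℕ} (hN : 0 < N) :
    ∫ θ in (0 : ℝ)..(2 * Real.pi), (Real.cos (N * θ) + Real.cos (N * θ) ^ 2) / 2 =
      Real.pi / 2 := by
  have hN' : (N : ℝ) ≠ 0 := by positivity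
  have h := intervalIntegral.integral_comp_mul_left (a := 0) (b := 2 * Real.pi)
    (fun x => (Real.cos x + Real.cos x ^ 2) / 2) hN'
  rw [h, intervalIntegral.integral_div, intervalIntegral.integral_add
    (Continuous.intervalIntegrable (by fun_prop) _ _)
    (Continuous.intervalIntegrable (by fun_prop) _ _), integral_cos, integral_cos_sq]
  have h1 : Real.sin (N * (2 * Real.pi)) = 0 := by
    have := Real.sin_nat_mul_pi (2 * N)
    push_cast at this
    rw [← this]
    ring_nf
  rw [h1]
  simp
  field_simp

theorem continuous_max_log_norm {g : ℂ → ℂ} {r : ℝ}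
    (hg : Continuous fun θ : ℝ => g (r * Complex.exp (θ * Complex.I))) :
    Continuous fun θ : ℝ => max (Real.log ‖g (r * Complex.exp (θ * Complex.I))‖) 0 := by
  simp_rw [max_comm _ (0 : ℝ)]
  exact Real.continuous_posLog.comp hg.norm

theorem div_four_le_proxFn {g : ℂ → ℂ} {r A : ℝ} {N : ℕ} (hN : 0 < N) (hA : 0 ≤ A)
    (hg : Continuous fun θ : ℝ => g (r * Complex.exp (θ * Complex.I)))
    (hlow : ∀ θ : ℝ, 0 ≤ Real.cos (N * θ) →
      Real.exp A ≤ ‖g (r * Complex.exp (θ * Complex.I))‖) :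
    A / 4 ≤ proxFn g r := by
  have hpi := Real.pi_pos
  have hint : A * (Real.pi / 2) ≤ ∫ θ in (0:ℝ)..(2 * Real.pi),
      max (Real.log ‖g ((r : ℂ) * Complex.exp (θ * Complex.I))‖) 0 := by
    rw [← integral_cos_add_cos_sq hN, ← intervalIntegral.integral_const_mul]
    refine intervalIntegral.integral_mono (by positivity)
      (Continuous.intervalIntegrable (by fun_prop) _ _)
      (Continuous.intervalIntegrable ?_ _ _) fun θ => ?_
    · exact continuous_max_log_norm hg
    · have h1 := Real.cos_le_one (N * θ)
      have h2 := Real.neg_one_le_cos (N * θ)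
      rcases le_total 0 (Real.cos (N * θ)) with hc | hc
      · refine le_trans ?_ (le_max_left _ _)
        have := (Real.le_log_iff_exp_le ((Real.exp_pos A).trans_le (hlow θ hc))).2 (hlow θ hc)
        refine le_trans (mul_le_of_le_one_right hA ?_) this
        nlinarith
      · refine le_trans ?_ (le_max_right _ _)
        refine mul_nonpos_of_nonneg_of_nonpos hA ?_
        nlinarith
  rw [proxFn, div_mul_eq_mul_div, le_div_iff₀ (by positivity)]
  nlinarith

theorem proxFn_le {g : ℂ → ℂ} {r B : ℝ} (hB : 0 ≤ B)
    (hg : Continuous fun θ : ℝ => g (r * Complex.exp (θ * Complex.I)))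
    (hup : ∀ θ : ℝ, ‖g (r * Complex.exp (θ * Complex.I))‖ ≤ Real.exp B) :
    proxFn g r ≤ B := by
  have hpi := Real.pi_pos
  have hint : ∫ θ in (0:ℝ)..(2 * Real.pi),
      max (Real.log ‖g ((r : ℂ) * Complex.exp (θ * Complex.I))‖) 0 ≤
      ∫ _ in (0:ℝ)..(2 * Real.pi), B := by
    refine intervalIntegral.integral_mono (by positivity)
      (Continuous.intervalIntegrable ?_ _ _)
      (Continuous.intervalIntegrable (by fun_prop) _ _) fun θ => max_le ?_ hB
    · exact continuous_max_log_norm hg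
    · rcases (norm_nonneg (g (r * Complex.exp (θ * Complex.I)))).eq_or_lt with h | h
      · rw [← h]
        simpa using hB
      · exact (Real.log_le_iff_le_exp h).2 (hup θ)
  rw [intervalIntegral.integral_const, smul_eq_mul] at hint
  rw [proxFn, div_mul_eq_mul_div, div_le_iff₀ (by positivity)]
  linarith

theorem le_Minf_and_Minf_le {g : ℂ → ℂ} {r A B : ℝ}
    (hlow : A ≤ ‖g (r * Complex.exp ((0 : ℝ) * Complex.I))‖)
    (hup : ∀ θ : ℝ, ‖g (r * Complex.exp (θ * Complex.I))‖ ≤ B) :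
    A ≤ Minf g r ∧ Minf g r ≤ B := by
  have hmem : ‖g (r * Complex.exp ((0 : ℝ) * Complex.I))‖ ∈
      (fun θ : ℝ => ‖g ((r : ℂ) * Complex.exp (θ * Complex.I))‖) '' Set.Icc 0 (2 * Real.pi) :=
    ⟨0, ⟨le_rfl, by positivity⟩, rfl⟩
  have hub : B ∈ upperBounds
      ((fun θ : ℝ => ‖g ((r : ℂ) * Complex.exp (θ * Complex.I))‖) ''
        Set.Icc 0 (2 * Real.pi)) := by
    rintro _ ⟨θ, _, rfl⟩
    exact hup θ
  exact ⟨hlow.trans (le_csSup ⟨B, hub⟩ hmem), csSup_le ⟨_, hmem⟩ hub⟩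

section Primitive

variable {φ : ℝ → ℝ}

theorem intervalIntegrable_of_mem_Ioo
    (hint : ∀ r ∈ Set.Ioo (0:ℝ) 1, IntervalIntegrable φ volume 0 r)
    {a b : ℝ} (ha : a ∈ Set.Ioo (0 : ℝ) 1) (hb : b ∈ Set.Ioo (0 : ℝ) 1) :
    IntervalIntegrable φ volume a b :=
  (hint a ha).symm.trans (hint b hb)

theorem primitive_mono (hnonneg : ∀ t ∈ Set.Ioo (0:ℝ) 1, 0 ≤ φ t)
    (hint : ∀ r ∈ Set.Ioo (0:ℝ) 1, IntervalIntegrable φ volume 0 r)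
    {a b : ℝ} (ha : a ∈ Set.Ioo (0 : ℝ) 1) (hb : b ∈ Set.Ioo (0 : ℝ) 1) (hab : a ≤ b) :
    ∫ t in (0 : ℝ)..a, φ t ≤ ∫ t in (0 : ℝ)..b, φ t := by
  rw [← sub_nonneg, intervalIntegral.integral_interval_sub_left (hint b hb) (hint a ha)]
  exact intervalIntegral.integral_nonneg hab fun t ht =>
    hnonneg t ⟨ha.1.trans_le ht.1, ht.2.trans_lt hb.2⟩

theorem exists_primitive_eq
    (hint : ∀ r ∈ Set.Ioo (0:ℝ) 1, IntervalIntegrable φ volume 0 r)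
    (hΦunbdd : Tendsto (fun r => ∫ t in (0:ℝ)..r, φ t) (nhdsWithin 1 (Set.Iio 1)) atTop)
    {y : ℝ} (hy : 0 < y) : ∃ r ∈ Set.Ioo (0 : ℝ) 1, ∫ t in (0 : ℝ)..r, φ t = y := by
  have hev : ∀ᶠ s in nhdsWithin (1 : ℝ) (Set.Iio 1), s ∈ Set.Ioo (0 : ℝ) 1 :=
    Ioo_mem_nhdsLT (by norm_num)
  obtain ⟨s, hs, hsy⟩ := (hev.and (hΦunbdd.eventually_ge_atTop y)).exists
  have hcont : ContinuousOn (fun r => ∫ t in (0:ℝ)..r, φ t) (Set.Icc 0 s) := by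
    have := intervalIntegral.continuousOn_primitive_interval (μ := volume) (f := φ) (a := 0)
      (b := s) (by
        rw [Set.uIcc_of_le hs.1.le]
        exact (intervalIntegrable_iff_integrableOn_Icc_of_le hs.1.le).1 (hint s hs))
    rwa [Set.uIcc_of_le hs.1.le] at this
  obtain ⟨r, hr, hry⟩ := intermediate_value_Icc hs.1.le hcont
    (show y ∈ Set.Icc _ _ from ⟨by simpa using hy.le, hsy⟩)
  refine ⟨r, ⟨hr.1.lt_of_ne ?_, hr.2.trans_lt hs.2⟩, hry⟩
  rintro rfl
  simp at hry
  linarith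

theorem exists_mul_one_sub_le (hmono : MonotoneOn φ (Set.Ioo 0 1))
    (hnonneg : ∀ t ∈ Set.Ioo (0:ℝ) 1, 0 ≤ φ t)
    (hcase :
      (∃ c C : ℝ, 0 < c ∧ 0 < C ∧ ∀ r ∈ Set.Ioo (0:ℝ) 1,
        c ≤ φ r * (1 - r) ∧ φ r * (1 - r) ≤ C) ∨
      Tendsto (fun r => φ r * (1 - r)) (nhdsWithin 1 (Set.Iio 1)) (nhds 0)) :
    ∃ C > 0, ∀ r ∈ Set.Ioo (0 : ℝ) 1, φ r * (1 - r) ≤ C := by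
  rcases hcase with ⟨c, C, -, hC, h⟩ | h
  · exact ⟨C, hC, fun r hr => (h r hr).2⟩
  · have hev := (h.eventually_le_const (show (0 : ℝ) < 1 by norm_num))
    obtain ⟨s, hs, hsub⟩ := (mem_nhdsLT_iff_exists_Ioo_subset' (show (0 : ℝ) < 1 by norm_num)).1 hev
    set m := max s (1 / 2)
    have hm : m ∈ Set.Ioo (0 : ℝ) 1 :=
      ⟨lt_max_of_lt_right (by norm_num), max_lt hs (by norm_num)⟩
    have hφm := hnonneg m hm
    refine ⟨max 1 (φ m), by positivity, fun r hr => ?_⟩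
    rcases le_or_gt r m with hrm | hrm
    · refine le_trans ?_ (le_max_right _ _)
      have h1 := hmono hr hm hrm
      have h2 := hnonneg r hr
      nlinarith [hr.1, hr.2]
    · exact le_trans (hsub ⟨(le_max_left _ _).trans_lt hrm, hr.2⟩) (le_max_left _ _)

theorem primitive_sub_le {C : ℝ} (hC : ∀ r ∈ Set.Ioo (0 : ℝ) 1, φ r * (1 - r) ≤ C)
    (hint : ∀ r ∈ Set.Ioo (0:ℝ) 1, IntervalIntegrable φ volume 0 r)
    {a b : ℝ} (ha : a ∈ Set.Ioo (0 : ℝ) 1) (hb : b ∈ Set.Ioo (0 : ℝ) 1) (hab : a ≤ b) :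
    (∫ t in (0 : ℝ)..b, φ t) - ∫ t in (0 : ℝ)..a, φ t ≤ C * Real.log ((1 - a) / (1 - b)) := by
  rw [intervalIntegral.integral_interval_sub_left (hint b hb) (hint a ha),
    ← integral_inv_of_pos (by linarith [hb.2]) (by linarith [ha.2]),
    ← intervalIntegral.integral_comp_sub_left (fun x => x⁻¹) 1,
    ← intervalIntegral.integral_const_mul]
  refine intervalIntegral.integral_mono_on hab (intervalIntegrable_of_mem_Ioo hint ha hb)
    (ContinuousOn.intervalIntegrable ?_) fun t ht => ?_
  · rw [Set.uIcc_of_le hab]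
    refine ContinuousOn.mul continuousOn_const (ContinuousOn.inv₀ (by fun_prop) fun t ht => ?_)
    linarith [ht.2, hb.2]
  · have ht1 : 0 < 1 - t := by linarith [ht.2, hb.2]
    rw [← div_eq_mul_inv, le_div_iff₀ ht1]
    exact hC t ⟨ha.1.trans_le ht.1, by linarith⟩

end Primitive

theorem exp_neg_three_le_pow_ceil {ρ : ℝ} (h : 1 / 2 ≤ ρ) (h1 : ρ < 1) :
    Real.exp (-3) ≤ ρ ^ ⌈(1 - ρ)⁻¹⌉₊ := by
  have hd : 0 < 1 - ρ := by linarith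
  have hceil := (Nat.ceil_lt_add_one (inv_nonneg.2 hd.le)).le
  have hρ : Real.exp (-(2 * (1 - ρ))) ≤ ρ := by
    rw [Real.exp_neg]
    refine inv_le_of_inv_le₀ (by linarith) ?_
    refine le_trans ?_ (Real.add_one_le_exp _)
    rw [inv_le_iff_one_le_mul₀ (by linarith)]
    nlinarith
  refine le_trans ?_ (pow_le_pow_left₀ (Real.exp_pos _).le hρ _)
  rw [← Real.exp_nat_mul]
  apply Real.exp_le_exp.2
  have := mul_le_mul_of_nonneg_right hceil hd.le
  rw [add_mul, inv_mul_cancel₀ hd.ne'] at this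
  linarith

theorem exp_mul_pow_ceil_le {a b u : ℝ} (ha : a ∈ Set.Ioo (0 : ℝ) 1)
    (h : 2 * u ≤ (1 - a) / (1 - b)) :
    Real.exp u * a ^ ⌈(1 - b)⁻¹⌉₊ ≤ Real.exp (-u) := by
  have hd : 0 ≤ 1 - a := by linarith [ha.2]
  have h1 : a ≤ Real.exp (-(1 - a)) := by
    linarith [Real.add_one_le_exp (-(1 - a))]
  have h2 := mul_le_mul_of_nonneg_right (Nat.le_ceil (1 - b)⁻¹) hd
  have h3 : (1 - a) / (1 - b) = (1 - b)⁻¹ * (1 - a) := by ring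
  calc _ ≤ Real.exp u * Real.exp (-(1 - a)) ^ ⌈(1 - b)⁻¹⌉₊ := by
        gcongr
        exact ha.1.le
    _ = Real.exp (u + ⌈(1 - b)⁻¹⌉₊ * (-(1 - a))) := by
        rw [← Real.exp_nat_mul, Real.exp_add]
    _ ≤ _ := Real.exp_le_exp.2 (by linarith)

theorem stmt19 (φ : ℝ → ℝ)
    (hcont : ContinuousOn φ (Set.Ioo 0 1))
    (hmono : MonotoneOn φ (Set.Ioo 0 1))
    (hnonneg : ∀ t ∈ Set.Ioo (0:ℝ) 1, 0 ≤ φ t)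
    (hint : ∀ r ∈ Set.Ioo (0:ℝ) 1, IntervalIntegrable φ volume 0 r)
    -- `φ` is unbounded:
    (hφunbdd : Tendsto φ (nhdsWithin 1 (Set.Iio 1)) atTop)
    -- `Φ(r) = ∫_0^r φ(t) dt` is unbounded:
    (hΦunbdd : Tendsto (fun r => ∫ t in (0:ℝ)..r, φ t) (nhdsWithin 1 (Set.Iio 1)) atTop)
    -- either `φ(r)(1-r) ≍ 1` or `φ(r)(1-r) → 0` as `r → 1⁻`:
    (hcase :
      (∃ c C : ℝ, 0 < c ∧ 0 < C ∧ ∀ r ∈ Set.Ioo (0:ℝ) 1,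
        c ≤ φ r * (1 - r) ∧ φ r * (1 - r) ≤ C) ∨
      Tendsto (fun r => φ r * (1 - r)) (nhdsWithin 1 (Set.Iio 1)) (nhds 0)) :
    ∃ g : ℂ → ℂ, DifferentiableOn ℂ g unitDisc ∧
      ∃ c C r₀ : ℝ, 0 < c ∧ 0 < C ∧ r₀ ∈ Set.Ioo (0:ℝ) 1 ∧
        ∀ r ∈ Set.Ioo r₀ 1,
          (c * (∫ t in (0:ℝ)..r, φ t) ≤ Real.log (Minf g r) ∧
            Real.log (Minf g r) ≤ C * (∫ t in (0:ℝ)..r, φ t)) ∧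
          (c * (∫ t in (0:ℝ)..r, φ t) ≤ proxFn g r ∧
            proxFn g r ≤ C * (∫ t in (0:ℝ)..r, φ t)) := by
  obtain ⟨C, hC0, hC⟩ := exists_mul_one_sub_le hmono hnonneg hcase
  set Φ : ℝ → ℝ := fun r => ∫ t in (0:ℝ)..r, φ t with hΦ
  have hΦmono : ∀ {a b : ℝ}, a ∈ Set.Ioo (0 : ℝ) 1 → b ∈ Set.Ioo (0 : ℝ) 1 → a ≤ b → Φ a ≤ Φ b :=
    fun ha hb hab => primitive_mono hnonneg hint ha hb hab
  have hlt : ∀ {a b : ℝ}, a ∈ Set.Ioo (0 : ℝ) 1 → b ∈ Set.Ioo (0 : ℝ) 1 → Φ a < Φ b → a < b :=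
    fun ha hb h => lt_of_not_ge fun hba => h.not_ge (hΦmono hb ha hba)
  have hhalf : (1 / 2 : ℝ) ∈ Set.Ioo (0 : ℝ) 1 := by norm_num
  have hΦhalf : 0 ≤ Φ (1 / 2) := intervalIntegral.integral_nonneg_of_ae_restrict hhalf.1.le (by
    rw [← restrict_Ioo_eq_restrict_Icc]
    filter_upwards [self_mem_ae_restrict measurableSet_Ioo] with t ht
    exact hnonneg t ⟨ht.1, ht.2.trans hhalf.2⟩)
  set L : ℝ := 10 + 16 * C ^ 2 + Φ (1 / 2) with hLdef
  have hC2 : 0 < 16 * C ^ 2 := by positivity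
  have hL : 10 ≤ L := by linarith
  have hu : ∀ j : ℕ, L ≤ L * 2 ^ j := fun j =>
    le_mul_of_one_le_right (by linarith) (one_le_pow₀ (by norm_num))
  have hpos : ∀ j : ℕ, 0 < L * 2 ^ j := fun j => by linarith [hu j]
  choose ρ hρ hΦρ using fun j : ℕ => exists_primitive_eq hint hΦunbdd (hpos j)
  have hΦρ' : ∀ j, Φ (ρ j) = L * 2 ^ j := hΦρ
  have hρhalf : ∀ j, 1 / 2 < ρ j := fun j => hlt hhalf (hρ j) (by
    rw [hΦρ']
    linarith [hu j])
  set n : ℕ → ℕ := fun j => ⌈(1 - ρ j)⁻¹⌉₊ with hn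
  have hmain : ∀ j, Real.exp (-3) ≤ ρ j ^ n j := fun j =>
    exp_neg_three_le_pow_ceil (hρhalf j).le (hρ j).2
  have htail : ∀ i j, i < j →
      Real.exp (L * 2 ^ j) * ρ i ^ n j ≤ Real.exp (-(L * 2 ^ j)) := by
    intro i j hij
    refine exp_mul_pow_ceil_le (hρ i) ?_
    set u := L * 2 ^ j with hudef
    have hΦij : Φ (ρ i) ≤ u / 2 := by
      rw [hΦρ' i, hudef]
      have : (2 : ℝ) ^ (i + 1) ≤ 2 ^ j := pow_le_pow_right₀ (by norm_num) hij
      rw [pow_succ] at this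
      nlinarith
    have hupos : 0 < u := hpos j
    have hρij : ρ i < ρ j := hlt (hρ i) (hρ j) (by
      rw [hΦρ' j]
      linarith)
    have hlog : Φ (ρ j) - Φ (ρ i) ≤ C * Real.log ((1 - ρ i) / (1 - ρ j)) :=
      primitive_sub_le hC hint (hρ i) (hρ j) hρij.le
    have hi : 0 < 1 - ρ i := by linarith [(hρ i).2]
    have hj : 0 < 1 - ρ j := by linarith [(hρ j).2]
    have h1 : u / (2 * C) ≤ Real.log ((1 - ρ i) / (1 - ρ j)) := by
      rw [div_le_iff₀ (by positivity)]
      rw [hΦρ' j] at hlog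
      linarith
    refine le_trans ?_ ((Real.le_log_iff_exp_le (by positivity)).1 h1)
    have hq := Real.quadratic_le_exp_of_nonneg (x := u / (2 * C)) (by positivity)
    have hLu : 16 * C ^ 2 ≤ u := by linarith [hu j]
    have h2 : 2 * u ≤ (u / (2 * C)) ^ 2 / 2 := by
      rw [div_pow, div_div, le_div_iff₀ (by positivity)]
      nlinarith
    have h3 : 0 < u / (2 * C) := by positivity
    linarith
  have hρ0 : ∀ j, 0 ≤ ρ j := fun j => (hρ j).1.le
  have hunbdd : ∀ s ∈ Set.Ioo (0 : ℝ) 1, ∃ k, s < ρ k := by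
    intro s hs
    obtain ⟨k, hk⟩ := pow_unbounded_of_one_lt (Φ s) (one_lt_two : (1 : ℝ) < 2)
    refine ⟨k, hlt hs (hρ k) (hk.trans_le ?_)⟩
    rw [hΦρ' k]
    exact le_mul_of_one_le_left (by positivity) (by linarith)
  have hdiff : DifferentiableOn ℂ (lacunarySeries L n) {z | ‖z‖ < 1} :=
    differentiableOn_lacunarySeries hL htail fun s hs => by
      rcases le_or_gt s 0 with h | h
      · exact ⟨0, h.trans_lt (hρ 0).1⟩
      · exact hunbdd s ⟨h, hs⟩
  refine ⟨lacunarySeries L n, hdiff, 1 / 16, 4, ρ 0, by norm_num, by norm_num, hρ 0,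
    fun r hr => ?_⟩
  change (1 / 16 * Φ r ≤ _ ∧ _ ≤ 4 * Φ r) ∧ (1 / 16 * Φ r ≤ _ ∧ _ ≤ 4 * Φ r)
  have hr0 : 0 < r := (hρ 0).1.trans hr.1
  have hr' : r ∈ Set.Ioo (0 : ℝ) 1 := ⟨hr0, hr.2⟩
  obtain ⟨k, hk, hk'⟩ : ∃ k, ρ k ≤ r ∧ r < ρ (k + 1) := by
    classical
    have hex := hunbdd r hr'
    obtain ⟨k, hk⟩ : ∃ k, Nat.find hex = k + 1 := Nat.exists_eq_succ_of_ne_zero fun h0 => by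
      have := Nat.find_spec hex
      rw [h0] at this
      exact lt_asymm this hr.1
    exact ⟨k, not_lt.1 (Nat.find_min hex (by omega)), hk ▸ Nat.find_spec hex⟩
  have hΦk : L * 2 ^ k ≤ Φ r := (hΦρ' k).symm.le.trans (hΦmono (hρ k) hr' hk)
  have hΦk' : Φ r ≤ 2 * (L * 2 ^ k) := by
    refine (hΦmono hr' (hρ (k + 1)) hk'.le).trans (le_of_eq ?_)
    rw [hΦρ' (k + 1)]
    ring
  obtain ⟨N, hN, hnN⟩ := exists_pos_add_exponent hL htail hmain hρ0 (fun j => (hρ j).2.le) k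
  have hnorm : ∀ θ : ℝ, ‖(r : ℂ) * Complex.exp (θ * Complex.I)‖ = r := fun θ => by
    rw [norm_mul, Complex.norm_exp_ofReal_mul_I, Complex.norm_real,
      Real.norm_of_nonneg hr0.le, mul_one]
  have hup : ∀ θ : ℝ, ‖lacunarySeries L n (r * Complex.exp (θ * Complex.I))‖ ≤
      Real.exp (4 * (L * 2 ^ k)) := fun θ =>
    norm_lacunarySeries_le hL htail ((hnorm θ).le.trans hr.2.le) ((hnorm θ).le.trans hk'.le)
  have hlow : ∀ θ : ℝ, 0 ≤ Real.cos (N * θ) → Real.exp (L * 2 ^ k / 2) ≤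
      ‖lacunarySeries L n (r * Complex.exp (θ * Complex.I))‖ := fun θ hθ =>
    exp_le_norm_lacunarySeries hL htail hmain hρ0 hnN hr.2.le hk hk'.le hθ
  have hgcont : Continuous fun θ : ℝ =>
      lacunarySeries L n (r * Complex.exp (θ * Complex.I)) :=
    hdiff.continuousOn.comp_continuous (by fun_prop) fun θ => (hnorm θ).trans_lt hr.2
  obtain ⟨hM, hM'⟩ := le_Minf_and_Minf_le (hlow 0 (by simp)) hup
  have hMpos := (Real.exp_pos _).trans_le hM
  have hpk := hpos k
  have hlogM := (Real.le_log_iff_exp_le hMpos).2 hM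
  have hlogM' := (Real.log_le_iff_le_exp hMpos).2 hM'
  have hm := div_four_le_proxFn hN (by positivity) hgcont hlow
  have hm' := proxFn_le (by positivity) hgcont hup
  exact ⟨⟨by linarith, by linarith⟩, by linarith, by linarith⟩
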